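/- Let A be a finite-dimensional G-graded K-algebra, with G a finite group such that char K ∤ |G|, and let M be a finitely generated graded A-module. Then M ⊗_K (KG)^* is a quasi-Koszul A # G^*-module if and only if M is a quasi-Koszul A-module. -/

import Mathlib

open CategoryTheory

universe u

noncomputable instance (A : Type u) [Ring A] : HasDerivedCategory (ModuleCat.{u} A) :=
  HasDerivedCategory.standard _

instance (A : Type u) [Ring A] : HasExt.{u+1} (ModuleCat.{u} A) :=
  CategoryTheory.hasExt_of_hasDerivedCategory _

/-- The Jacobson radical of a ring, as a left ideal. -/
def jacRad (A : Type u) [Ring A] : Ideal A := Ideal.jacobson ⊥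

/-- The semisimple quotient `A/J(A)` as a left `A`-module. -/
abbrev ssQuot (A : Type u) [Ring A] : ModuleCat.{u} A :=
  ModuleCat.of A (A ⧸ jacRad A)

/-- A ring is semiperfect if `A/J(A)` is semisimple and idempotents lift
modulo the Jacobson radical. -/
def IsSemiperfectRing (A : Type u) [Ring A] : Prop :=
  IsSemisimpleModule A (A ⧸ jacRad A) ∧
    ∀ a : A, a * a - a ∈ jacRad A →
      ∃ e : A, IsIdempotentElem e ∧ e - a ∈ jacRad A

/-- Additive span of Yoneda products. -/
noncomputable def extSpan {C : Type (u+1)} [Category C] [Abelian C] [HasExt.{u+1} C]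
    (X Y Z : C) (r l : ℕ) : AddSubgroup (Abelian.Ext X Z (r + l)) :=
  AddSubgroup.closure { γ | ∃ (α : Abelian.Ext X Y r) (β : Abelian.Ext Y Z l), γ = α.comp β rfl }

/-- A ring `A` is quasi-Koszul if its Yoneda algebra `Ext^*_A(A/J, A/J)` is generated in
degrees 0 and 1: `Ext^i · Ext^1 = Ext^{i+1}` for all `i ≥ 0`. -/
def IsQuasiKoszul (A : Type u) [Ring A] : Prop :=
  ∀ i : ℕ, extSpan (ssQuot A) (ssQuot A) (ssQuot A) i 1 = ⊤

/-- An `A`-module `M` is quasi-Koszul if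
`Ext^i_A(M, A/J) · Ext^1_A(A/J, A/J) = Ext^{i+1}_A(M, A/J)` for all `i ≥ 0`. -/
def IsQuasiKoszulModule (A : Type u) [Ring A] (M : ModuleCat.{u} A) : Prop :=
  ∀ i : ℕ, extSpan M (ssQuot A) (ssQuot A) i 1 = ⊤


/-- `B` is a smash product `A # G^*` of the `G`-graded `K`-algebra `A` (with grading `𝒜`)
with the dual of the group algebra of the finite group `G` : `B` contains `A`, and a
complete family of orthogonal idempotents `u g` (the images of the dual basis `p_g`)
satisfying the smash commutation rule `(1 # p_g)(a # p_h) = a_{gh⁻¹} # p_h`, and `B` is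
free as an `A`-module with basis the `u g`. -/
structure IsSmashProduct (K : Type u) [Field K] (A : Type u) [Ring A] [Algebra K A]
    (G : Type u) [Group G] [Fintype G] [DecidableEq G]
    (𝒜 : G → Submodule K A) [DirectSum.Decomposition 𝒜]
    (B : Type u) [Ring B] [Algebra K B] where
  ι : A →ₐ[K] B
  u : G → B
  idem : ∀ g : G, u g * u g = u g
  orth : ∀ g h : G, g ≠ h → u g * u h = 0
  sum_u : ∑ g : G, u g = 1
  comm : ∀ (g h : G) (a : A),
    u g * (ι a * u h) = ι ((DirectSum.decompose 𝒜 a (g * h⁻¹) : 𝒜 (g * h⁻¹)) : A) * u h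
  free : ∀ b : B, ∃! c : G → A, b = ∑ g : G, ι (c g) * u g

section Categorical

open Abelian

universe v

variable {C : Type (u + 1)} [Category.{v} C] [Abelian C]

/-- `N` is a retract of a finite direct sum of copies of `S`. -/
def IsSumRetract (N S : C) : Prop :=
  ∃ (n : ℕ) (p : Fin n → (N ⟶ S)) (i : Fin n → (S ⟶ N)), ∑ k, p k ≫ i k = 𝟙 N

lemma IsSumRetract.map {D : Type (u + 1)} [Category.{v} D] [Abelian D] (F : C ⥤ D) [F.Additive]
    {N S : C} (h : IsSumRetract N S) : IsSumRetract (F.obj N) (F.obj S) := by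
  obtain ⟨n, p, i, hpi⟩ := h
  refine ⟨n, fun k => F.map (p k), fun k => F.map (i k), ?_⟩
  simp only [← F.map_comp, ← F.map_sum, hpi, F.map_id]

lemma IsSumRetract.of_retract {N N' S : C} (h : IsSumRetract N S) (p : N' ⟶ N) (i : N ⟶ N')
    (hpi : p ≫ i = 𝟙 N') : IsSumRetract N' S := by
  obtain ⟨n, p', i', h'⟩ := h
  refine ⟨n, fun k => p ≫ p' k, fun k => i' k ≫ i, ?_⟩
  calc ∑ k, (p ≫ p' k) ≫ i' k ≫ i = p ≫ (∑ k, p' k ≫ i' k) ≫ i := by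
        simp only [Preadditive.sum_comp, Preadditive.comp_sum, Category.assoc]
    _ = 𝟙 N' := by rw [h', Category.id_comp, hpi]

variable [HasExt.{u + 1} C]

lemma comp_mem_extSpan {X Y Z : C} {r l : ℕ} (α : Ext X Y r) (β : Ext Y Z l) :
    α.comp β rfl ∈ extSpan X Y Z r l :=
  AddSubgroup.subset_closure ⟨α, β, rfl⟩

lemma comp_mem_extSpan_of_isSumRetract {X N S Z : C} (h : IsSumRetract N S) {r l : ℕ}
    (α : Ext X N r) (β : Ext N Z l) : α.comp β rfl ∈ extSpan X S Z r l := by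
  obtain ⟨n, p, i, hpi⟩ := h
  have : α.comp β rfl = ∑ k, (α.comp (Ext.mk₀ (p k)) (add_zero r)).comp
      ((Ext.mk₀ (i k)).comp β (zero_add l)) rfl := by
    have h1 : ∀ k, (α.comp (Ext.mk₀ (p k)) (add_zero r)).comp
        ((Ext.mk₀ (i k)).comp β (zero_add l)) rfl =
        (α.comp (Ext.mk₀ (p k ≫ i k)) (add_zero r)).comp β rfl := by
      intro k
      rw [Ext.comp_assoc_of_second_deg_zero, Ext.mk₀_comp_mk₀_assoc,
        ← Ext.comp_assoc_of_second_deg_zero]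
    rw [Finset.sum_congr rfl fun k _ => h1 k, ← Ext.sum_comp, ← Ext.comp_sum, ← Ext.mk₀_sum, hpi,
      Ext.comp_mk₀_id]
  rw [this]
  exact AddSubgroup.sum_mem _ fun k _ => comp_mem_extSpan _ _

lemma extSpan_postcomp {X Y Z Z' : C} {r l : ℕ} (f : Z ⟶ Z') {γ : Ext X Z (r + l)}
    (hγ : γ ∈ extSpan X Y Z r l) : γ.comp (Ext.mk₀ f) (add_zero _) ∈ extSpan X Y Z' r l := by
  induction hγ using AddSubgroup.closure_induction with
  | mem γ hγ =>
    obtain ⟨α, β, rfl⟩ := hγ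
    rw [Ext.comp_assoc_of_third_deg_zero]
    exact comp_mem_extSpan _ _
  | zero => rw [Ext.zero_comp]; exact zero_mem _
  | add x y _ _ hx hy => rw [Ext.add_comp]; exact add_mem hx hy
  | neg x _ hx => rw [Ext.neg_comp]; exact neg_mem hx

lemma extSpan_precomp {X X' Y Z : C} {r l : ℕ} (f : X' ⟶ X) {γ : Ext X Z (r + l)}
    (hγ : γ ∈ extSpan X Y Z r l) : (Ext.mk₀ f).comp γ (zero_add _) ∈ extSpan X' Y Z r l := by
  induction hγ using AddSubgroup.closure_induction with
  | mem γ hγ =>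
    obtain ⟨α, β, rfl⟩ := hγ
    rw [← Ext.comp_assoc (a₁₂ := r) _ _ _ (zero_add r) rfl (by lia)]
    exact comp_mem_extSpan _ _
  | zero => rw [Ext.comp_zero]; exact zero_mem _
  | add x y _ _ hx hy => rw [Ext.comp_add]; exact add_mem hx hy
  | neg x _ hx => rw [Ext.comp_neg]; exact neg_mem hx

lemma extSpan_eq_top_of_isSumRetract_right {X Y Z Z' : C} (h : IsSumRetract Z' Z) {r l : ℕ}
    (ht : extSpan X Y Z r l = ⊤) : extSpan X Y Z' r l = ⊤ := by
  obtain ⟨n, p, i, hpi⟩ := h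
  rw [eq_top_iff]
  intro γ _
  have : γ = ∑ k, (γ.comp (Ext.mk₀ (p k)) (add_zero _)).comp (Ext.mk₀ (i k)) (add_zero _) := by
    have h1 : ∀ k, (γ.comp (Ext.mk₀ (p k)) (add_zero _)).comp (Ext.mk₀ (i k)) (add_zero _) =
        γ.comp (Ext.mk₀ (p k ≫ i k)) (add_zero _) := by
      intro k
      rw [Ext.comp_assoc_of_third_deg_zero, Ext.mk₀_comp_mk₀]
    rw [Finset.sum_congr rfl fun k _ => h1 k, ← Ext.comp_sum, ← Ext.mk₀_sum, hpi,
      Ext.comp_mk₀_id]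
  rw [this]
  refine AddSubgroup.sum_mem _ fun k _ => extSpan_postcomp _ ?_
  rw [ht]
  trivial

lemma extSpan_eq_top_of_isSumRetract_left {X X' Y Z : C} (h : IsSumRetract X' X) {r l : ℕ}
    (ht : extSpan X Y Z r l = ⊤) : extSpan X' Y Z r l = ⊤ := by
  obtain ⟨n, p, i, hpi⟩ := h
  rw [eq_top_iff]
  intro γ _
  have : γ = ∑ k, (Ext.mk₀ (p k)).comp ((Ext.mk₀ (i k)).comp γ (zero_add _)) (zero_add _) := by
    simp only [Ext.mk₀_comp_mk₀_assoc]
    rw [← Ext.sum_comp, ← Ext.mk₀_sum, hpi, Ext.mk₀_id_comp]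
  rw [this]
  refine AddSubgroup.sum_mem _ fun k _ => extSpan_precomp _ ?_
  rw [ht]
  trivial

variable {D : Type (u + 1)} [Category.{v} D] [Abelian D] [HasExt.{u + 1} D]

open Limits

section Naturality

variable (R : D ⥤ C) (Q : C ⥤ D) [R.Additive] [Q.Additive]
  [PreservesFiniteLimits R] [PreservesFiniteColimits R]
  [PreservesFiniteLimits Q] [PreservesFiniteColimits Q]

lemma mapExactFunctor_mapExactFunctor_extClass {S : ShortComplex D} (hS : S.ShortExact) :
    (hS.extClass.mapExactFunctor R).mapExactFunctor Q =
      ((hS.map_of_exact R).map_of_exact Q).extClass :=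
  (congrArg (Ext.mapExactFunctor Q) (Ext.mapExactFunctor_extClass R hS)).trans
    (Ext.mapExactFunctor_extClass Q _)

/-- Every extension of positive degree is a product with the class of a short exact sequence. -/
lemma exists_extClass_comp_eq [EnoughProjectives D] {n : ℕ} {X Y : D} (γ : Ext X Y (n + 1)) :
    ∃ (S : ShortComplex D) (hS : S.ShortExact) (h : S.X₃ = X) (δ : Ext S.X₁ Y n),
      h ▸ hS.extClass.comp δ (Nat.add_comm 1 n) = γ := by
  let S : ShortComplex D := ShortComplex.mk (kernel.ι (Projective.π X)) (Projective.π X) (by simp)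
  have hS : S.ShortExact := { exact := ShortComplex.exact_kernel _ }
  obtain ⟨δ, hδ⟩ := Ext.contravariant_sequence_exact₃ hS Y γ
    (Ext.eq_zero_of_projective _) (Nat.add_comm 1 n)
  exact ⟨S, hS, rfl, δ, hδ⟩

/-- A natural transformation `𝟭 D ⟶ R ⋙ Q` with `R` and `Q` exact is natural with respect to the
action of `R` and `Q` on extensions. -/
lemma mapExactFunctor_unit_naturality [EnoughProjectives D]
    (η : 𝟭 D ⟶ R ⋙ Q) {n : ℕ} {X Y : D} (γ : Ext X Y n) :
    (Ext.mk₀ (η.app X)).comp ((γ.mapExactFunctor R).mapExactFunctor Q) (zero_add n) =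
      γ.comp (Ext.mk₀ (η.app Y)) (add_zero n) := by
  induction n generalizing X Y with
  | zero =>
    obtain ⟨f, rfl⟩ := (Ext.mk₀_bijective X Y).2 γ
    rw [Ext.mapExactFunctor_mk₀, Ext.mapExactFunctor_mk₀, Ext.mk₀_comp_mk₀, Ext.mk₀_comp_mk₀]
    exact congrArg _ (η.naturality f).symm
  | succ n ih =>
    obtain ⟨S, hS, rfl, δ, rfl⟩ := exists_extClass_comp_eq γ
    have h1 : hS.extClass.comp (Ext.mk₀ (η.app S.X₁)) (add_zero 1) =
        (Ext.mk₀ (η.app S.X₃)).comp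
          ((hS.extClass.mapExactFunctor R).mapExactFunctor Q) (zero_add 1) := by
      rw [mapExactFunctor_mapExactFunctor_extClass]
      exact ShortComplex.ShortExact.extClass_naturality hS
        ((hS.map_of_exact R).map_of_exact Q) (S.mapNatTrans η)
    simp only [Ext.mapExactFunctor_comp]
    rw [← Ext.comp_assoc (a₁₂ := 1) _ _ _ (zero_add 1) (Nat.add_comm 1 n) (by lia), ← h1,
      Ext.comp_assoc_of_second_deg_zero, ih, Ext.comp_assoc_of_third_deg_zero]

/-- A natural transformation `R ⋙ Q ⟶ 𝟭 D` with `R` and `Q` exact is natural with respect to the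
action of `R` and `Q` on extensions. -/
lemma mapExactFunctor_counit_naturality [EnoughProjectives D]
    (ε : R ⋙ Q ⟶ 𝟭 D) {n : ℕ} {X Y : D} (γ : Ext X Y n) :
    ((γ.mapExactFunctor R).mapExactFunctor Q).comp (Ext.mk₀ (ε.app Y)) (add_zero n) =
      (Ext.mk₀ (ε.app X)).comp γ (zero_add n) := by
  induction n generalizing X Y with
  | zero =>
    obtain ⟨f, rfl⟩ := (Ext.mk₀_bijective X Y).2 γ
    rw [Ext.mapExactFunctor_mk₀, Ext.mapExactFunctor_mk₀]
    refine (Ext.mk₀_comp_mk₀ _ _).trans ((congrArg _ (ε.naturality f)).trans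
      (Ext.mk₀_comp_mk₀ _ _).symm)
  | succ n ih =>
    obtain ⟨S, hS, rfl, δ, rfl⟩ := exists_extClass_comp_eq γ
    have h1 : ((hS.extClass.mapExactFunctor R).mapExactFunctor Q).comp
          (Ext.mk₀ (ε.app S.X₁)) (add_zero 1) =
        (Ext.mk₀ (ε.app S.X₃)).comp hS.extClass (zero_add 1) := by
      rw [mapExactFunctor_mapExactFunctor_extClass]
      exact ShortComplex.ShortExact.extClass_naturality
        ((hS.map_of_exact R).map_of_exact Q) hS (S.mapNatTrans ε)
    simp only [Ext.mapExactFunctor_comp]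
    rw [Ext.comp_assoc_of_third_deg_zero, ih]
    refine (Ext.comp_assoc_of_second_deg_zero _ _ _ _).symm.trans ?_
    rw [h1]
    exact Ext.comp_assoc (a₁₂ := 1) _ _ _ (zero_add 1) (Nat.add_comm 1 n) (by lia)

end Naturality

/-- Let `R ⊣ Q` be an adjunction between exact functors such that `R` and `Q` match the objects
`T` and `S` up to finite direct sums and retracts. Then `Ext(X, T)` is generated in degree `0` over
`Ext(T, T)` if and only if `Ext(R X, S)` is generated in degree `0` over `Ext(S, S)`. -/
theorem extSpan_eq_top_iff_of_adjunction [EnoughProjectives C] [EnoughProjectives D]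
    {R : D ⥤ C} {Q : C ⥤ D} [R.Additive] [Q.Additive]
    [PreservesFiniteLimits R] [PreservesFiniteColimits R]
    [PreservesFiniteLimits Q] [PreservesFiniteColimits Q] (adj : R ⊣ Q) {S : C} {T : D}
    (hRT : IsSumRetract (R.obj T) S) (hQS : IsSumRetract (Q.obj S) T)
    (hTQ : IsSumRetract T (Q.obj S)) (X : D) (r l : ℕ) :
    extSpan X T T r l = ⊤ ↔ extSpan (R.obj X) S S r l = ⊤ := by
  constructor
  · intro h
    rw [eq_top_iff]
    intro γ _
    have key : γ = (((Ext.mk₀ (adj.unit.app X)).comp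
        (γ.mapExactFunctor Q) (zero_add _)).mapExactFunctor R).comp
          (Ext.mk₀ (adj.counit.app S)) (add_zero _) := by
      rw [Ext.mapExactFunctor_comp, Ext.comp_assoc_of_third_deg_zero,
        mapExactFunctor_counit_naturality, Ext.mapExactFunctor_mk₀]
      refine .trans ?_ (Ext.mk₀_comp_mk₀_assoc _ _ _).symm
      exact ((congrArg (fun f => (Ext.mk₀ f).comp γ (zero_add _))
        (adj.left_triangle_components X)).trans (Ext.mk₀_id_comp _)).symm
    have hmem : (Ext.mk₀ (adj.unit.app X)).comp (γ.mapExactFunctor Q) (zero_add _) ∈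
        extSpan X T (Q.obj S) r l := by
      rw [extSpan_eq_top_of_isSumRetract_right hQS h]
      trivial
    rw [key]
    generalize (Ext.mk₀ (adj.unit.app X)).comp (γ.mapExactFunctor Q) (zero_add _) = ξ at hmem
    refine extSpan_postcomp _ ?_
    induction hmem using AddSubgroup.closure_induction with
    | mem ξ hξ =>
      obtain ⟨α, β, rfl⟩ := hξ
      rw [Ext.mapExactFunctor_comp]
      exact comp_mem_extSpan_of_isSumRetract hRT _ _
    | zero => rw [Ext.mapExactFunctor_zero]; exact zero_mem _
    | add x y _ _ hx hy => rw [Ext.mapExactFunctor_add]; exact add_mem hx hy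
    | neg x _ hx =>
      rw [← Functor.mapExtAddHom_apply, map_neg]; exact neg_mem hx
  · intro h
    refine extSpan_eq_top_of_isSumRetract_right hTQ ?_
    rw [eq_top_iff]
    intro γ _
    have key : γ = (Ext.mk₀ (adj.unit.app X)).comp (((γ.mapExactFunctor R).comp
        (Ext.mk₀ (adj.counit.app S)) (add_zero _)).mapExactFunctor Q) (zero_add _) := by
      rw [Ext.mapExactFunctor_comp, ← Ext.comp_assoc_of_third_deg_zero,
        mapExactFunctor_unit_naturality, Ext.mapExactFunctor_mk₀]
      refine .trans ?_ (Ext.comp_assoc_of_third_deg_zero _ _ _ _).symm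
      refine .trans ?_ (congrArg (γ.comp · _) (Ext.mk₀_comp_mk₀ _ _).symm)
      rw [adj.right_triangle_components]
      exact (Ext.comp_mk₀_id _).symm
    have hmem : (γ.mapExactFunctor R).comp (Ext.mk₀ (adj.counit.app S)) (add_zero _) ∈
        extSpan (R.obj X) S S r l := by
      rw [h]
      trivial
    rw [key]
    generalize (γ.mapExactFunctor R).comp (Ext.mk₀ (adj.counit.app S)) (add_zero _) = ξ at hmem
    refine extSpan_precomp _ ?_
    induction hmem using AddSubgroup.closure_induction with
    | mem ξ hξ =>
      obtain ⟨α, β, rfl⟩ := hξ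
      rw [Ext.mapExactFunctor_comp]
      exact comp_mem_extSpan_of_isSumRetract hQS _ _
    | zero => rw [Ext.mapExactFunctor_zero]; exact zero_mem _
    | add x y _ _ hx hy => rw [Ext.mapExactFunctor_add]; exact add_mem hx hy
    | neg x _ hx =>
      rw [← Functor.mapExtAddHom_apply, map_neg]; exact neg_mem hx

end Categorical

section Artinian

variable {A : Type u} [Ring A]

lemma isSemisimpleModule_of_jacRad_smul [IsArtinianRing A] {N : Type*} [AddCommGroup N] [Module A N]
    (h : ∀ a ∈ jacRad A, ∀ x : N, a • x = 0) : IsSemisimpleModule A N := by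
  have hN : Module.IsTorsionBySet A N (Ring.jacobson A) := by
    rintro x ⟨a, ha⟩
    exact h a (by rwa [jacRad, Ideal.jacobson_bot]) x
  let := hN.module
  exact hN.isSemisimpleModule_iff.mp inferInstance

lemma jacRad_smul_eq_zero {N : Type*} [AddCommGroup N] [Module A N] [IsSemisimpleModule A N]
    {a : A} (ha : a ∈ jacRad A) (x : N) : a • x = 0 := by
  rw [jacRad, Ideal.jacobson_bot] at ha
  exact Module.mem_annihilator.mp (IsSemisimpleModule.jacobson_le_annihilator A N ha) x

lemma jacRad_smul_ssQuot {a : A} (ha : a ∈ jacRad A) (x : A ⧸ jacRad A) : a • x = 0 := by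
  obtain ⟨b, rfl⟩ := Submodule.Quotient.mk_surjective _ x
  rw [← Submodule.Quotient.mk_smul, Submodule.Quotient.mk_eq_zero, smul_eq_mul]
  rw [jacRad, Ideal.jacobson_bot] at ha ⊢
  exact Ideal.mul_mem_right b _ ha

/-- A left ideal all of whose elements are nilpotent is contained in the radical. -/
lemma le_jacRad_of_isNilpotent {I : Ideal A} (h : ∀ x ∈ I, IsNilpotent x) : I ≤ jacRad A := by
  intro x hx
  rw [jacRad, Ideal.mem_jacobson_iff]
  intro y
  obtain ⟨w, hw⟩ := (h (y * x) (I.mul_mem_left y hx)).isUnit_add_one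
  refine ⟨↑w⁻¹, ?_⟩
  have : (↑w⁻¹ : A) * (y * x + 1) = 1 := by rw [← hw, Units.inv_mul]
  rw [mul_add, mul_one] at this
  rw [mul_assoc, this, sub_self]
  exact zero_mem _

lemma isNilpotent_of_mem_jacRad [IsArtinianRing A] {x : A} (hx : x ∈ jacRad A) : IsNilpotent x := by
  obtain ⟨n, hn⟩ := IsArtinianRing.isNilpotent_jacobson_bot (R := A)
  refine ⟨n, ?_⟩
  have : x ^ n ∈ (Ideal.jacobson (⊥ : Ideal A)) ^ n := Ideal.pow_mem_pow hx n
  rw [hn] at this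
  simpa using this

lemma isSumRetract_ssQuot [IsArtinianRing A] {N : ModuleCat.{u} A} [Module.Finite A N]
    (h : ∀ a ∈ jacRad A, ∀ x : N, a • x = 0) : IsSumRetract N (ssQuot A) := by
  obtain ⟨n, s, hs⟩ := Module.Finite.exists_fin (R := A) (M := N)
  let q : Fin n → (A ⧸ jacRad A) →ₗ[A] N := fun k =>
    (jacRad A).liftQ (LinearMap.toSpanSingleton A N (s k)) fun a ha => by
      simpa using h a ha (s k)
  let f : (Fin n → A ⧸ jacRad A) →ₗ[A] N := ∑ k, q k ∘ₗ LinearMap.proj k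
  have hf : Function.Surjective f := by
    rw [← LinearMap.range_eq_top, eq_top_iff, ← hs, Submodule.span_le]
    rintro _ ⟨k, rfl⟩
    refine ⟨Pi.single k (Submodule.Quotient.mk 1), ?_⟩
    have : ∀ j, q j (Pi.single (M := fun _ => A ⧸ jacRad A) k (Submodule.Quotient.mk 1) j) =
        if j = k then s k else 0 := by
      intro j
      by_cases hj : j = k
      · subst hj
        simp [q]
      · simp [hj]
    simp only [f, LinearMap.sum_apply, LinearMap.comp_apply, LinearMap.proj_apply, this]
    simp
  have : IsSemisimpleModule A (Fin n → A ⧸ jacRad A) :=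
    isSemisimpleModule_of_jacRad_smul fun a ha x => funext fun k => jacRad_smul_ssQuot ha (x k)
  obtain ⟨g, hg⟩ := IsSemisimpleModule.lifting_property f hf LinearMap.id
  refine ⟨n, fun k => ModuleCat.ofHom (LinearMap.proj k ∘ₗ g), fun k => ModuleCat.ofHom (q k), ?_⟩
  ext x
  have := LinearMap.congr_fun hg x
  simpa [f, ModuleCat.hom_sum] using this

end Artinian

section Graded

variable {K : Type*} [Field K] {V : Type*} [AddCommGroup V] [Module K V] {ι G : Type*}

lemma sum_decompose [Fintype ι] [DecidableEq ι] (𝒱 : ι → Submodule K V)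
    [DirectSum.Decomposition 𝒱] (a : V) :
    ∑ g, ((DirectSum.decompose 𝒱 a g : 𝒱 g) : V) = a := by
  classical
  conv_rhs => rw [← DirectSum.sum_support_decompose 𝒱 a]
  symm
  refine Finset.sum_subset (Finset.subset_univ _) fun g _ hg => ?_
  simpa using hg

lemma sum_decompose_mul_inv [Group G] [Fintype G] [DecidableEq G]
    (𝒱 : G → Submodule K V) [DirectSum.Decomposition 𝒱] (a : V) (h : G) :
    ∑ g, ((DirectSum.decompose 𝒱 a (g * h⁻¹) : 𝒱 (g * h⁻¹)) : V) = a := by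
  conv_rhs => rw [← sum_decompose 𝒱 a]
  exact Fintype.sum_equiv (Equiv.mulRight h⁻¹) _ _ fun g => rfl

lemma sum_inv_decompose [Group G] [Fintype G] [DecidableEq G]
    (𝒱 : G → Submodule K V) [DirectSum.Decomposition 𝒱] (a : V) (g : G) :
    ∑ h, ((DirectSum.decompose 𝒱 a (g * h⁻¹) : 𝒱 (g * h⁻¹)) : V) = a := by
  conv_rhs => rw [← sum_decompose 𝒱 a]
  exact Fintype.sum_equiv ((Equiv.inv G).trans (Equiv.mulLeft g)) _ _ fun h => rfl

open TensorProduct in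
lemma sum_tmul_single [Fintype ι] [DecidableEq ι] (z : V ⊗[K] (ι → K)) :
    ∑ h, (TensorProduct.rid K V ((LinearMap.proj h : (ι → K) →ₗ[K] K).lTensor V z)) ⊗ₜ[K]
      (Pi.single h (1 : K) : ι → K) = z := by
  induction z with
  | zero => simp
  | add x y hx hy =>
    simp only [map_add, TensorProduct.add_tmul, Finset.sum_add_distrib]
    rw [hx, hy]
  | tmul m f =>
    simp only [LinearMap.lTensor_tmul, TensorProduct.rid_tmul, TensorProduct.smul_tmul,
      LinearMap.proj_apply]
    rw [← TensorProduct.tmul_sum]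
    congr 1
    ext g
    simp [Finset.sum_apply, Pi.single_apply]

end Graded

namespace IsSmashProduct

variable {K : Type u} [Field K] {A : Type u} [Ring A] [Algebra K A]
  {G : Type u} [Group G] [Fintype G] [DecidableEq G]
  {𝒜 : G → Submodule K A} [DirectSum.Decomposition 𝒜]
  {B : Type u} [Ring B] [Algebra K B] (HS : IsSmashProduct K A G 𝒜 B)

/-- The coordinates of an element of the smash product in the basis `u`. -/
noncomputable def coord (b : B) : G → A := (HS.free b).choose

lemma sum_coord (b : B) : ∑ g, HS.ι (HS.coord b g) * HS.u g = b :=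
  ((HS.free b).choose_spec.1).symm

lemma coord_sum (c : G → A) : HS.coord (∑ g, HS.ι (c g) * HS.u g) = c :=
  ((HS.free _).choose_spec.2 c rfl).symm

lemma coord_add (b b' : B) : HS.coord (b + b') = HS.coord b + HS.coord b' := by
  conv_lhs => rw [← HS.sum_coord b, ← HS.sum_coord b', ← Finset.sum_add_distrib]
  simp only [← add_mul, ← map_add]
  exact HS.coord_sum (HS.coord b + HS.coord b')

lemma coord_ι_mul (a : A) (b : B) (g : G) : HS.coord (HS.ι a * b) g = a * HS.coord b g := by
  conv_lhs => rw [← HS.sum_coord b, Finset.mul_sum]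
  simp only [← mul_assoc, ← map_mul]
  exact congrFun (HS.coord_sum fun g => a * HS.coord b g) g

lemma coord_u (g : G) : HS.coord (HS.u g) = Pi.single g 1 := by
  conv_lhs => rw [show HS.u g = ∑ h, HS.ι ((Pi.single g 1 : G → A) h) * HS.u h by
    rw [Finset.sum_eq_single g]
    · simp
    · intro h _ hh
      simp [hh]
    · simp]
  exact HS.coord_sum _

lemma coord_one (g : G) : HS.coord 1 g = 1 := by
  rw [show (1 : B) = ∑ h, HS.ι ((fun _ => 1 : G → A) h) * HS.u h by simp [HS.sum_u]]
  rw [coord_sum]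

lemma ι_injective : Function.Injective HS.ι := by
  intro a b hab
  have h := HS.coord_ι_mul a 1 1
  rw [hab, coord_ι_mul, coord_one, mul_one, mul_one] at h
  exact h.symm

lemma mul_u (b : B) (g : G) : b * HS.u g = HS.ι (HS.coord b g) * HS.u g := by
  conv_lhs => rw [← HS.sum_coord b, Finset.sum_mul]
  rw [Finset.sum_eq_single g]
  · rw [mul_assoc, HS.idem]
  · intro h _ hh
    rw [mul_assoc, HS.orth h g hh, mul_zero]
  · simp

lemma u_mul_ι (g : G) (a : A) : HS.u g * HS.ι a =
    ∑ h, HS.ι ((DirectSum.decompose 𝒜 a (g * h⁻¹) : 𝒜 (g * h⁻¹)) : A) * HS.u h := by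
  simp only [← HS.comm, ← Finset.mul_sum, HS.sum_u, mul_one]

lemma coord_u_mul_ι (g : G) (a : A) (h : G) :
    HS.coord (HS.u g * HS.ι a) h = (DirectSum.decompose 𝒜 a (g * h⁻¹) : 𝒜 (g * h⁻¹)) := by
  rw [u_mul_ι]
  exact congrFun (HS.coord_sum fun h => _) h

lemma coord_mul_ι (b : B) (a : A) (h : G) : HS.coord (b * HS.ι a) h =
    ∑ g, HS.coord b g * (DirectSum.decompose 𝒜 a (g * h⁻¹) : 𝒜 (g * h⁻¹)) := by
  let φ : B →+ A :=
    { toFun := fun b => HS.coord b h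
      map_zero' := by have := congrFun (HS.coord_add 0 0) h; simpa using this
      map_add' := fun b b' => by rw [coord_add]; rfl }
  change φ _ = _
  conv_lhs => rw [← HS.sum_coord b, Finset.sum_mul, map_sum]
  refine Finset.sum_congr rfl fun g _ => ?_
  rw [mul_assoc]
  exact (HS.coord_ι_mul _ _ _).trans (by rw [coord_u_mul_ι])

/-- The smash product is free over `A`, as an additive group. -/
noncomputable def coordEquiv : B ≃+ (G → A) where
  toFun := HS.coord
  invFun c := ∑ g, HS.ι (c g) * HS.u g
  left_inv := HS.sum_coord
  right_inv := HS.coord_sum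
  map_add' := HS.coord_add

lemma isArtinianRing [FiniteDimensional K A] (HS : IsSmashProduct K A G 𝒜 B) :
    IsArtinianRing B := by
  let f : (G → A) →ₗ[K] B :=
    ∑ g, LinearMap.mulRight K (HS.u g) ∘ₗ HS.ι.toLinearMap ∘ₗ LinearMap.proj g
  have hf : Function.Surjective f := fun b => ⟨HS.coord b, by
    simpa [f] using HS.sum_coord b⟩
  have : Module.Finite K B := Module.Finite.of_surjective f hf
  exact isArtinian_of_tower K inferInstance

/-- The endomorphism of the smash product that fixes `A` and sends `u g` to `u (g * t)`. -/
noncomputable def shift (t : G) : B →+* B where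
  toFun b := ∑ g, HS.ι (HS.coord b g) * HS.u (g * t)
  map_one' := by
    simp only [coord_one, map_one, one_mul]
    rw [← HS.sum_u]
    exact Fintype.sum_equiv (Equiv.mulRight t) _ _ fun g => rfl
  map_zero' := by
    have : HS.coord 0 = 0 := HS.coordEquiv.map_zero
    simp [this]
  map_add' b b' := by
    simp only [coord_add, Pi.add_apply, map_add, add_mul, Finset.sum_add_distrib]
  map_mul' b b' := by
    have h1 : HS.coord (b * b') = fun h => ∑ g, HS.coord b g *
        (DirectSum.decompose 𝒜 (HS.coord b' h) (g * h⁻¹) : 𝒜 (g * h⁻¹)) := by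
      rw [← HS.coord_sum fun h => ∑ g, HS.coord b g *
        (DirectSum.decompose 𝒜 (HS.coord b' h) (g * h⁻¹) : 𝒜 (g * h⁻¹))]
      congr 1
      conv_lhs => rw [← HS.sum_coord b', Finset.mul_sum]
      refine Finset.sum_congr rfl fun h _ => ?_
      rw [← mul_assoc, mul_u, coord_mul_ι]
    rw [h1, Finset.sum_mul]
    simp only [map_sum, map_mul, Finset.sum_mul]
    rw [Finset.sum_comm]
    refine Finset.sum_congr rfl fun g _ => ?_
    rw [Finset.mul_sum]
    refine Finset.sum_congr rfl fun h _ => ?_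
    rw [mul_assoc, mul_assoc, HS.comm]
    rw [show g * t * (h * t)⁻¹ = g * h⁻¹ by group]

lemma shift_ι_mul_u (t : G) (a : A) (g : G) :
    HS.shift t (HS.ι a * HS.u g) = HS.ι a * HS.u (g * t) := by
  change ∑ h, HS.ι (HS.coord _ h) * HS.u (h * t) = _
  rw [Finset.sum_eq_single g]
  · rw [coord_ι_mul, coord_u, Pi.single_eq_same, mul_one]
  · intro h _ hh
    rw [coord_ι_mul, coord_u, Pi.single_eq_of_ne hh, mul_zero, map_zero, zero_mul]
  · simp

lemma shift_surjective (t : G) : Function.Surjective (HS.shift t) := by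
  intro b
  refine ⟨∑ g, HS.ι (HS.coord b g) * HS.u (g * t⁻¹), ?_⟩
  rw [map_sum]
  simp only [shift_ι_mul_u, inv_mul_cancel_right, sum_coord]

lemma shift_mem_jacRad (t : G) {b : B} (hb : b ∈ jacRad B) : HS.shift t b ∈ jacRad B := by
  have : RingHomSurjective (HS.shift t) := ⟨HS.shift_surjective t⟩
  rw [jacRad, Ideal.jacobson_bot] at hb ⊢
  exact Ring.le_comap_jacobson (HS.shift t) hb

lemma ι_coord_mem_jacRad {b : B} (hb : b ∈ jacRad B) (g : G) :
    HS.ι (HS.coord b g) ∈ jacRad B := by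
  have h1 : HS.ι (HS.coord b g) * HS.u g ∈ jacRad B := by
    rw [← mul_u]
    rw [jacRad, Ideal.jacobson_bot] at hb ⊢
    exact Ideal.mul_mem_right _ _ hb
  have h2 : HS.ι (HS.coord b g) = ∑ h, HS.shift (g⁻¹ * h) (HS.ι (HS.coord b g) * HS.u g) := by
    simp only [shift_ι_mul_u, mul_inv_cancel_left, ← Finset.mul_sum, HS.sum_u, mul_one]
  rw [h2]
  exact Ideal.sum_mem _ fun h _ => HS.shift_mem_jacRad _ h1

lemma coord_mem_jacRad [FiniteDimensional K A] {b : B} (hb : b ∈ jacRad B) (g : G) :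
    HS.coord b g ∈ jacRad A := by
  have := HS.isArtinianRing
  have hle : (jacRad B).comap (HS.ι : A →+* B) ≤ jacRad A := by
    refine le_jacRad_of_isNilpotent fun x hx => ?_
    obtain ⟨n, hn⟩ := isNilpotent_of_mem_jacRad (Ideal.mem_comap.mp hx)
    refine ⟨n, HS.ι_injective ?_⟩
    rw [map_pow, map_zero]
    exact hn
  exact hle (Ideal.mem_comap.mpr (HS.ι_coord_mem_jacRad hb g))

end IsSmashProduct

section ChangeOfRings

variable {A B : Type u} [Ring A] [Ring B] (f : A →+* B)

instance : (ModuleCat.coextendScalars.{u, u, u} f).Additive where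
  map_add := by
    intros
    ext
    rfl

lemma preservesFiniteLimits_and_colimits_restrictScalars :
    Limits.PreservesFiniteLimits (ModuleCat.restrictScalars.{u} f) ∧
      Limits.PreservesFiniteColimits (ModuleCat.restrictScalars.{u} f) := by
  refine ((Functor.exact_tfae (ModuleCat.restrictScalars.{u} f)).out 1 3).mp fun S h => ?_
  rw [ShortComplex.ShortExact.moduleCat_exact_iff_function_exact] at h ⊢
  exact h

end ChangeOfRings

namespace IsSmashProduct

variable {K : Type u} [Field K] {A : Type u} [Ring A] [Algebra K A]
  {G : Type u} [Group G] [Fintype G] [DecidableEq G]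
  {𝒜 : G → Submodule K A} [DirectSum.Decomposition 𝒜]
  {B : Type u} [Ring B] [Algebra K B] (HS : IsSmashProduct K A G 𝒜 B)

/-- Restriction of scalars along `A → A # G^*`. -/
noncomputable abbrev res : ModuleCat.{u} B ⥤ ModuleCat.{u} A :=
  ModuleCat.restrictScalars (HS.ι : A →+* B)

/-- Coextension of scalars along `A → A # G^*`. -/
noncomputable abbrev coext : ModuleCat.{u} A ⥤ ModuleCat.{u} B :=
  ModuleCat.coextendScalars (HS.ι : A →+* B)

/-- The evaluation of an element of a coextended module. -/
noncomputable def eval {X : ModuleCat.{u} A} (f : HS.coext.obj X) (b : B) : X :=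
  ModuleCat.CoextendScalars.equiv (HS.ι : A →+* B) X f b

variable {X : ModuleCat.{u} A}

lemma eval_add (f : HS.coext.obj X) (b b' : B) : HS.eval f (b + b') = HS.eval f b + HS.eval f b' :=
  map_add (ModuleCat.CoextendScalars.equiv (HS.ι : A →+* B) X f) b b'

lemma eval_ι_mul (f : HS.coext.obj X) (a : A) (b : B) :
    HS.eval f (HS.ι a * b) = a • HS.eval f b :=
  (ModuleCat.CoextendScalars.equiv (HS.ι : A →+* B) X f).map_smul a b

lemma add_eval (f f' : HS.coext.obj X) (b : B) : HS.eval (f + f') b = HS.eval f b + HS.eval f' b :=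
  rfl

lemma smul_eval (c : B) (f : HS.coext.obj X) (b : B) : HS.eval (c • f) b = HS.eval f (b * c) :=
  rfl

variable {HS} in
lemma ext_eval {f f' : HS.coext.obj X} (h : ∀ b, HS.eval f b = HS.eval f' b) : f = f' :=
  ModuleCat.CoextendScalars.ext (LinearMap.ext h)

lemma eval_map {Y : ModuleCat.{u} A} (φ : X ⟶ Y) (f : HS.coext.obj X) (b : B) :
    HS.eval (HS.coext.map φ f) b = φ (HS.eval f b) :=
  rfl

lemma eval_eq_sum (f : HS.coext.obj X) (b : B) :
    HS.eval f b = ∑ g, HS.coord b g • HS.eval f (HS.u g) := by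
  let φ : B →+ X := AddMonoidHom.mk' (HS.eval f) (HS.eval_add f)
  change φ b = _
  conv_lhs => rw [← HS.sum_coord b, map_sum]
  exact Finset.sum_congr rfl fun g _ => HS.eval_ι_mul f _ _

/-- The element of the coextended module with prescribed values at the `u g`. -/
noncomputable def ofValues (v : G → X) : HS.coext.obj X :=
  (ModuleCat.CoextendScalars.equiv (HS.ι : A →+* B) X).symm
    { toFun := fun b : B => ∑ g, HS.coord b g • v g
      map_add' := fun b b' : B => by
        change ∑ g, HS.coord (b + b') g • v g = _
        simp only [coord_add, Pi.add_apply, add_smul, Finset.sum_add_distrib]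
      map_smul' := fun a (b : B) => by
        change ∑ g, HS.coord (HS.ι a * b) g • v g = a • ∑ g, HS.coord b g • v g
        simp only [coord_ι_mul, mul_smul, Finset.smul_sum] }

lemma eval_ofValues (v : G → X) (b : B) :
    HS.eval (HS.ofValues v) b = ∑ g, HS.coord b g • v g :=
  rfl

lemma eval_ofValues_u (v : G → X) (g : G) : HS.eval (HS.ofValues v) (HS.u g) = v g := by
  rw [eval_ofValues, coord_u, Finset.sum_eq_single g]
  · simp
  · intro h _ hh
    simp [hh]
  · simp

variable {HS} in
lemma ext_u {f f' : HS.coext.obj X} (h : ∀ g, HS.eval f (HS.u g) = HS.eval f' (HS.u g)) :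
    f = f' :=
  ext_eval fun b => by
    rw [eval_eq_sum, HS.eval_eq_sum f']
    simp only [h]

/-- The element of the coextended module with constant value at the `u g`. -/
noncomputable def const (x : X) : HS.coext.obj X := HS.ofValues fun _ => x

lemma eval_const_one (x : X) : HS.eval (HS.const x) 1 = Fintype.card G • x := by
  simp [const, eval_ofValues, coord_one]

lemma const_add (x y : X) : HS.const (x + y) = HS.const x + HS.const y :=
  ext_u fun g => by simp only [const, add_eval, eval_ofValues_u]

lemma const_smul (a : A) (x : X) : HS.const (a • x) = HS.ι a • HS.const x := by
  refine ext_u fun g => ?_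
  simp only [const, smul_eval, eval_ofValues_u]
  rw [eval_ofValues, ← Finset.sum_smul]
  simp only [coord_u_mul_ι, sum_inv_decompose]

lemma ofValues_eq_sum (a : G → A) (x : X) :
    HS.ofValues (fun g => a g • x) = (∑ g, HS.u g * HS.ι (a g)) • HS.const x := by
  simp only [Finset.sum_smul, mul_smul, ← const_smul]
  have hsum : ∀ (F : G → HS.coext.obj X) (b : B),
      HS.eval (∑ g, F g) b = ∑ g, HS.eval (F g) b := fun F b =>
    map_sum (AddMonoidHom.mk' (fun f : HS.coext.obj X => HS.eval f b)
      fun f f' => HS.add_eval f f' b) F _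
  refine ext_u fun h => ?_
  rw [hsum, eval_ofValues_u, Finset.sum_eq_single h]
  · rw [smul_eval, HS.idem, const, eval_ofValues_u]
  · intro g _ hg
    rw [smul_eval, HS.orth h g hg.symm, eval_eq_sum]
    have : HS.coord 0 = 0 := HS.coordEquiv.map_zero
    simp [this]
  · simp

lemma coext_map_surjective {Y : ModuleCat.{u} A} (φ : X ⟶ Y) (hφ : Function.Surjective φ) :
    Function.Surjective (HS.coext.map φ) := by
  intro f
  choose v hv using fun g => hφ (HS.eval f (HS.u g))
  refine ⟨HS.ofValues v, ext_u fun g => ?_⟩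
  rw [eval_map, eval_ofValues_u, hv]

lemma preservesFiniteLimits_coext : Limits.PreservesFiniteLimits HS.coext := by
  have : Limits.PreservesLimitsOfSize.{0, 0} HS.coext :=
    (ModuleCat.restrictCoextendScalarsAdj.{u, u, u}
      (HS.ι : A →+* B)).rightAdjoint_preservesLimits
  exact ⟨fun J => inferInstance⟩

lemma preservesFiniteColimits_coext : Limits.PreservesFiniteColimits HS.coext := by
  have := HS.preservesFiniteLimits_coext
  have : HS.coext.PreservesEpimorphisms := ⟨fun φ hφ => by
    rw [ModuleCat.epi_iff_surjective] at hφ ⊢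
    exact HS.coext_map_surjective φ hφ⟩
  have := Functor.preservesHomology_of_preservesEpis_and_kernels HS.coext
  exact HS.coext.preservesFiniteColimits_of_preservesHomology

lemma finite_coext_ssQuot : Module.Finite B (HS.coext.obj (ssQuot A)) := by
  refine ⟨⟨{HS.const (X := ssQuot A) (Submodule.Quotient.mk 1 : A ⧸ jacRad A)}, ?_⟩⟩
  rw [Finset.coe_singleton, eq_top_iff]
  rintro f -
  choose a ha using fun g => Submodule.Quotient.mk_surjective (jacRad A) (HS.eval f (HS.u g))
  refine Submodule.mem_span_singleton.mpr ⟨∑ g, HS.u g * HS.ι (a g), ?_⟩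
  rw [← ofValues_eq_sum]
  refine ext_u fun g => ?_
  rw [eval_ofValues_u, ← ha]
  change a g • (Submodule.Quotient.mk 1 : A ⧸ jacRad A) = _
  rw [← Submodule.Quotient.mk_smul, smul_eq_mul, mul_one]

lemma jacRad_smul_coext (h : ∀ b ∈ jacRad B, ∀ (g : G) (x : X), HS.coord b g • x = 0)
    {b : B} (hb : b ∈ jacRad B) (f : HS.coext.obj X) : b • f = 0 := by
  refine ext_eval fun y => ?_
  rw [smul_eval, eval_eq_sum]
  exact Finset.sum_eq_zero fun g _ => h _ ((jacRad B).mul_mem_left y hb) g _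

lemma isSumRetract_coext_ssQuot [FiniteDimensional K A] :
    IsSumRetract (HS.coext.obj (ssQuot A)) (ssQuot B) := by
  have := HS.isArtinianRing
  have := HS.finite_coext_ssQuot
  exact isSumRetract_ssQuot fun b hb f => HS.jacRad_smul_coext
    (fun b hb g x => jacRad_smul_ssQuot (HS.coord_mem_jacRad hb g) x) hb f

lemma isSemisimpleModule_coext_res_ssQuot [FiniteDimensional K A] :
    IsSemisimpleModule B (HS.coext.obj (HS.res.obj (ssQuot B))) := by
  have := HS.isArtinianRing
  exact isSemisimpleModule_of_jacRad_smul fun b hb f => HS.jacRad_smul_coext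
    (fun b hb g x => jacRad_smul_ssQuot (A := B) (HS.ι_coord_mem_jacRad hb g) x) hb f

/-- An averaging argument: if the coextension of `X` is semisimple, then so is `X`. -/
lemma isSemisimpleModule_of_coext (hchar : (Fintype.card G : K) ≠ 0)
    [IsSemisimpleModule B (HS.coext.obj X)] : IsSemisimpleModule A X := by
  rw [isSemisimpleModule_iff, complementedLattice_iff]
  intro N
  let j : ModuleCat.of A N ⟶ X := ModuleCat.ofHom N.subtype
  have hj : Function.Injective (HS.coext.map j).hom := fun f f' hf => ext_eval fun b =>
    Subtype.ext (congrArg (fun t => HS.eval t b) hf)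
  obtain ⟨ρ, hρ⟩ := IsSemisimpleModule.extension_property (HS.coext.map j).hom hj LinearMap.id
  let c : A := algebraMap K A (Fintype.card G : K)⁻¹
  have hc : ∀ (V : Type u) [AddCommGroup V] [Module A V] (x : V), c • Fintype.card G • x = x := by
    intro V _ _ x
    rw [← Nat.cast_smul_eq_nsmul A, smul_smul, ← map_natCast (algebraMap K A), ← map_mul,
      inv_mul_cancel₀ hchar, map_one, one_smul]
  have hcomm : ∀ a : A, c * a = a * c := fun a => Algebra.commutes _ _
  let p : X →ₗ[A] N :=
    { toFun := fun x => c • (show N from HS.eval (ρ (HS.const x)) 1)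
      map_add' := fun x y => by
        rw [const_add, map_add, add_eval]
        exact smul_add _ _ _
      map_smul' := fun a x => by
        rw [const_smul, map_smul, smul_eval, one_mul, ← mul_one (HS.ι a), eval_ι_mul]
        change c • a • (show N from _) = a • c • (show N from _)
        rw [smul_smul, hcomm, mul_smul] }
  refine ⟨LinearMap.ker p, LinearMap.isCompl_of_proj fun x => ?_⟩
  have h1 : HS.const (X := X) (x : X) = HS.coext.map j (HS.const (X := ModuleCat.of A N) x) :=
    ext_u fun g => by rw [eval_map, const, const, eval_ofValues_u, eval_ofValues_u]; rfl
  have h2 : ρ (HS.const (X := X) (x : X)) = HS.const (X := ModuleCat.of A N) x := by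
    rw [h1]
    exact LinearMap.congr_fun hρ _
  change c • (show N from HS.eval (ρ (HS.const (X := X) (x : X))) 1) = x
  rw [h2, eval_const_one]
  exact hc N x

lemma finite_res_ssQuot : Module.Finite A (HS.res.obj (ssQuot B)) := by
  let f : (G → A) →ₗ[A] HS.res.obj (ssQuot B) :=
    Fintype.linearCombination A fun g =>
      (show HS.res.obj (ssQuot B) from (Submodule.Quotient.mk (HS.u g) : B ⧸ jacRad B))
  refine Module.Finite.of_surjective f fun x => ?_
  obtain ⟨b, rfl⟩ := Submodule.Quotient.mk_surjective (jacRad B) x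
  refine ⟨HS.coord b, ?_⟩
  rw [Fintype.linearCombination_apply]
  conv_rhs => rw [← HS.sum_coord b]
  exact (map_sum (jacRad B).mkQ _ _).symm

lemma isSumRetract_res_ssQuot [FiniteDimensional K A] (hchar : (Fintype.card G : K) ≠ 0) :
    IsSumRetract (HS.res.obj (ssQuot B)) (ssQuot A) := by
  have := isArtinian_of_tower K (S := A) (M := A) inferInstance
  have : IsArtinianRing A := this
  have := HS.isSemisimpleModule_coext_res_ssQuot
  have := HS.isSemisimpleModule_of_coext (X := HS.res.obj (ssQuot B)) hchar
  have := HS.finite_res_ssQuot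
  exact isSumRetract_ssQuot fun a ha x => jacRad_smul_eq_zero ha x

lemma isSumRetract_ssQuot_coext [FiniteDimensional K A] (hchar : (Fintype.card G : K) ≠ 0) :
    IsSumRetract (ssQuot B) (HS.coext.obj (ssQuot A)) := by
  have : IsSemisimpleModule B ((HS.res ⋙ HS.coext).obj (ssQuot B)) :=
    HS.isSemisimpleModule_coext_res_ssQuot
  let η := (ModuleCat.restrictCoextendScalarsAdj.{u, u, u} (HS.ι : A →+* B)).unit.app (ssQuot B)
  have hη : Function.Injective η.hom := fun x y hxy => by
    have h : (1 : B) • (show B ⧸ jacRad B from x) = (1 : B) • (show B ⧸ jacRad B from y) :=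
      congrArg (fun t => HS.eval t 1) hxy
    rwa [one_smul, one_smul] at h
  obtain ⟨ρ, hρ⟩ := IsSemisimpleModule.extension_property η.hom hη LinearMap.id
  refine ((HS.isSumRetract_res_ssQuot hchar).map HS.coext).of_retract η (ModuleCat.ofHom ρ) ?_
  exact ModuleCat.hom_ext (LinearMap.ext fun x => LinearMap.congr_fun hρ x)

theorem extSpan_eq_top_iff_res [FiniteDimensional K A] (hchar : (Fintype.card G : K) ≠ 0)
    (Y : ModuleCat.{u} B) (r l : ℕ) :
    extSpan Y (ssQuot B) (ssQuot B) r l = ⊤ ↔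
      extSpan (HS.res.obj Y) (ssQuot A) (ssQuot A) r l = ⊤ := by
  have := (preservesFiniteLimits_and_colimits_restrictScalars (HS.ι : A →+* B)).1
  have := (preservesFiniteLimits_and_colimits_restrictScalars (HS.ι : A →+* B)).2
  have := HS.preservesFiniteLimits_coext
  have := HS.preservesFiniteColimits_coext
  exact extSpan_eq_top_iff_of_adjunction
    (ModuleCat.restrictCoextendScalarsAdj.{u, u, u} (HS.ι : A →+* B))
    (HS.isSumRetract_res_ssQuot hchar) HS.isSumRetract_coext_ssQuot
    (HS.isSumRetract_ssQuot_coext hchar) Y r l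

section TensorDual

open TensorProduct

variable (M : Type u) [AddCommGroup M] [Module A M] [Module K M]
  (ℳ : G → Submodule K M) [DirectSum.Decomposition ℳ] [Module B (M ⊗[K] (G → K))]

lemma ι_smul_tmul_single
    (hMB : ∀ (a : A) (g : G) (m : M) (h : G),
      (HS.ι a * HS.u g) • (m ⊗ₜ[K] (Pi.single h (1 : K) : G → K)) =
        (a • ((DirectSum.decompose ℳ m (g * h⁻¹) : ℳ (g * h⁻¹)) : M)) ⊗ₜ[K]
          (Pi.single h (1 : K) : G → K))
    (a : A) (m : M) (h : G) :
    HS.ι a • (m ⊗ₜ[K] (Pi.single h (1 : K) : G → K)) =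
      (a • m) ⊗ₜ[K] (Pi.single h (1 : K) : G → K) := by
  rw [← mul_one (HS.ι a), ← HS.sum_u, Finset.mul_sum, Finset.sum_smul]
  simp only [hMB]
  rw [← TensorProduct.sum_tmul, ← Finset.smul_sum, sum_decompose_mul_inv ℳ]

/-- As `A`-modules, `M ⊗ (KG)^*` and `M` are direct summands of finite sums of each other. -/
lemma isSumRetract_tensor
    (hMB : ∀ (a : A) (g : G) (m : M) (h : G),
      (HS.ι a * HS.u g) • (m ⊗ₜ[K] (Pi.single h (1 : K) : G → K)) =
        (a • ((DirectSum.decompose ℳ m (g * h⁻¹) : ℳ (g * h⁻¹)) : M)) ⊗ₜ[K]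
          (Pi.single h (1 : K) : G → K)) :
    IsSumRetract (HS.res.obj (ModuleCat.of B (M ⊗[K] (G → K)))) (ModuleCat.of A M) ∧
      IsSumRetract (ModuleCat.of A M) (HS.res.obj (ModuleCat.of B (M ⊗[K] (G → K)))) := by
  let q : G → M ⊗[K] (G → K) →+ M := fun h =>
    ((TensorProduct.rid K M).toLinearMap ∘ₗ
      (LinearMap.proj h : (G → K) →ₗ[K] K).lTensor M).toAddMonoidHom
  have hq : ∀ h m k, q h (m ⊗ₜ[K] (Pi.single k (1 : K) : G → K)) = if h = k then m else 0 := by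
    intro h m k
    by_cases hh : h = k
    · subst hh
      simp [q]
    · simp [q, hh]
  have hqs : ∀ z, ∑ h, q h z ⊗ₜ[K] (Pi.single h (1 : K) : G → K) = z := sum_tmul_single
  have hqa : ∀ h (a : A) z, q h (HS.ι a • z) = a • q h z := by
    intro h a z
    conv_lhs => rw [← hqs z, Finset.smul_sum, map_sum]
    simp only [HS.ι_smul_tmul_single M ℳ hMB, hq]
    simp
  let Y := HS.res.obj (ModuleCat.of B (M ⊗[K] (G → K)))
  let p : G → (Y ⟶ ModuleCat.of A M) := fun h => ModuleCat.ofHom (X := Y)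
    { toFun := q h
      map_add' := (q h).map_add
      map_smul' := hqa h }
  let i : G → (ModuleCat.of A M ⟶ Y) := fun h => ModuleCat.ofHom (Y := Y)
    { toFun := fun m => m ⊗ₜ[K] (Pi.single h (1 : K) : G → K)
      map_add' := fun m m' => TensorProduct.add_tmul _ _ _
      map_smul' := fun a m => (HS.ι_smul_tmul_single M ℳ hMB a m h).symm }
  let e := Fintype.equivFin G
  refine ⟨⟨Fintype.card G, fun k => p (e.symm k), fun k => i (e.symm k), ?_⟩,
    ⟨1, fun _ => i 1, fun _ => p 1, ?_⟩⟩
  · rw [e.symm.sum_comp fun h => p h ≫ i h]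
    ext z
    rw [ModuleCat.hom_sum, LinearMap.sum_apply]
    exact hqs z
  · ext m
    rw [Fin.sum_univ_one]
    exact (hq 1 m 1).trans (if_pos rfl)

end TensorDual

end IsSmashProduct

/- STATEMENT 19: For a finite-dimensional G-graded K-algebra A with char K ∤ |G| and a
finitely generated graded A-module M, the A # G^*-module M ⊗_K (KG)^* is quasi-Koszul
iff M is a quasi-Koszul A-module. -/

open TensorProduct

theorem stmt19 (K : Type u) [Field K] (A : Type u) [Ring A] [Algebra K A]
    [FiniteDimensional K A]
    (G : Type u) [Group G] [Fintype G] [DecidableEq G]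
    (𝒜 : G → Submodule K A) [DirectSum.Decomposition 𝒜]
    (hone : (1 : A) ∈ 𝒜 1)
    (hmul : ∀ (g h : G) (a b : A), a ∈ 𝒜 g → b ∈ 𝒜 h → a * b ∈ 𝒜 (g * h))
    (B : Type u) [Ring B] [Algebra K B]
    (HS : IsSmashProduct K A G 𝒜 B)
    (hchar : (Fintype.card G : K) ≠ 0)
    -- M : a finitely generated graded A-module
    (M : Type u) [AddCommGroup M] [Module A M] [Module K M] [Module.Finite A M]
    (ℳ : G → Submodule K M) [DirectSum.Decomposition ℳ]
    (hM : ∀ (g h : G) (a : A) (m : M), a ∈ 𝒜 g → m ∈ ℳ h → a • m ∈ ℳ (g * h))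
    -- the A # G^*-module structure on M ⊗_K (KG)^*
    [Module B (M ⊗[K] (G → K))]
    (hMB : ∀ (a : A) (g : G) (m : M) (h : G),
      (HS.ι a * HS.u g) • (m ⊗ₜ[K] (Pi.single h (1 : K) : G → K)) =
        (a • ((DirectSum.decompose ℳ m (g * h⁻¹) : ℳ (g * h⁻¹)) : M)) ⊗ₜ[K]
          (Pi.single h (1 : K) : G → K)) :
    IsQuasiKoszulModule B (ModuleCat.of B (M ⊗[K] (G → K))) ↔
      IsQuasiKoszulModule A (ModuleCat.of A M) := by
  obtain ⟨h1, h2⟩ := HS.isSumRetract_tensor M ℳ hMB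
  refine forall_congr' fun i => (HS.extSpan_eq_top_iff_res hchar _ i 1).trans ⟨?_, ?_⟩
  · exact extSpan_eq_top_of_isSumRetract_left h2
  · exact extSpan_eq_top_of_isSumRetract_left h1
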